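/- (Coercivity at fixed scale, straight-layer geometry.) Let λ₁, μ₁, λ₂, μ₂ ∈ ℝ satisfy the Gutiérrez conditions 0 < −λ₂−μ₂ = μ₁ < μ₂ and λ₁+μ₁ > 0, let θ ∈ (0,1), ε > 0, and let Ω ⊂ ℝ² be a bounded open set. Define λ_ε(x) := λ₁ and μ_ε(x) := μ₁ when the fractional part of x₁/ε lies in [0,θ), and λ_ε(x) := λ₂, μ_ε(x) := μ₂ otherwise. Then there exists α > 0 such that for every smooth compactly supported v : Ω → ℝ², ∫_Ω [ λ_ε(x)(div v)² + 2μ_ε(x)|e(v)|² + |v|² ] dx ≥ α ∫_Ω ( |v|² + |Dv|² ) dx. -/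

import Mathlib

open Matrix MeasureTheory

/-- The Jacobian matrix of `v : ℝ² → ℝ²`: `(Dv)_{ij} = ∂v_i/∂x_j`. -/
noncomputable def jacobian (v : (Fin 2 → ℝ) → (Fin 2 → ℝ)) (x : Fin 2 → ℝ) :
    Matrix (Fin 2) (Fin 2) ℝ :=
  Matrix.of fun i j => fderiv ℝ v x (Pi.single j 1) i

/-- `div v = tr(Dv)`. -/
noncomputable def divg (v : (Fin 2 → ℝ) → (Fin 2 → ℝ)) (x : Fin 2 → ℝ) : ℝ :=
  (jacobian v x).trace

/-- The squared Frobenius norm of the symmetrized gradient `e(v) = (Dv + Dvᵀ)/2`. -/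
noncomputable def symGradNormSq (v : (Fin 2 → ℝ) → (Fin 2 → ℝ)) (x : Fin 2 → ℝ) : ℝ :=
  ∑ i, ∑ j, ((jacobian v x i j + jacobian v x j i) / 2) ^ 2

lemma aux_cont_fderiv {α : ℝ × ℝ → ℝ} (hα : ContDiff ℝ 2 α) (w : ℝ × ℝ) :
    Continuous fun z => fderiv ℝ α z w :=
  (hα.continuous_fderiv (by norm_num)).clm_apply continuous_const

lemma aux_fderiv2 {β : ℝ × ℝ → ℝ} (hβ : ContDiff ℝ 2 β) (z w : ℝ × ℝ) :
    HasFDerivAt (fun z => fderiv ℝ β z w) ((fderiv ℝ (fderiv ℝ β) z).flip w) z := by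
  have h : ContDiff ℝ 1 (fderiv ℝ β) := hβ.fderiv_right (by norm_num)
  have h2 := (h.differentiable (by norm_num) z).hasFDerivAt
  have := h2.clm_apply (hasFDerivAt_const w z)
  refine this.congr_fderiv ?_
  ext <;> simp

lemma aux_div {α β : ℝ × ℝ → ℝ} (hα : ContDiff ℝ 2 α) (hβ : ContDiff ℝ 2 β) (R : ℝ) (hR : 0 ≤ R)
    (h0 : ∀ t, α (t, R) = 0) (h1 : ∀ t, α (t, -R) = 0) :
    ∫ z in Set.Icc ((0 : ℝ), -R) (1, R),
      ((1 - z.1) ^ 2 * (fderiv ℝ α z (1, 0) * fderiv ℝ β z (0, 1)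
        - fderiv ℝ α z (0, 1) * fderiv ℝ β z (1, 0))
        - 2 * (1 - z.1) * (α z * fderiv ℝ β z (0, 1)))
      = - ∫ y in (-R)..R, α (0, y) * fderiv ℝ β (0, y) (0, 1) := by
  have hαc := hα.continuous
  have ca := aux_cont_fderiv hα
  have cb := aux_cont_fderiv hβ
  have hpsi : ∀ z : ℝ × ℝ, HasFDerivAt (fun z : ℝ × ℝ => (1 - z.1) ^ 2)
      ((2 * (1 - z.1)) • (-(ContinuousLinearMap.fst ℝ ℝ ℝ))) z := by
    intro z
    have := ((hasFDerivAt_fst (𝕜 := ℝ) (p := z)).const_sub 1).pow 2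
    refine this.congr_fderiv ?_
    ext <;> simp
  have hA : ∀ z, HasFDerivAt α (fderiv ℝ α z) z := fun z =>
    (hα.differentiable (by norm_num) z).hasFDerivAt
  have key := integral_divergence_prod_Icc_of_hasFDerivAt_of_le
    (fun z => (1 - z.1) ^ 2 * (α z * fderiv ℝ β z (0, 1)))
    (fun z => -((1 - z.1) ^ 2 * (α z * fderiv ℝ β z (1, 0))))
    _ _ ((0 : ℝ), -R) (1, R) (by constructor <;> (simp; try linarith))
    (by fun_prop) (by fun_prop)
    (fun z _ => (hpsi z).mul ((hA z).mul (aux_fderiv2 hβ z (0, 1))))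
    (fun z _ => ((hpsi z).mul ((hA z).mul (aux_fderiv2 hβ z (1, 0)))).neg)
  have e : ∀ z : ℝ × ℝ, fderiv ℝ (fderiv ℝ β) z (1, 0) (0, 1)
      = fderiv ℝ (fderiv ℝ β) z (0, 1) (1, 0) := fun z =>
    (hβ.contDiffAt.isSymmSndFDerivAt (by simp)) (1, 0) (0, 1)
  have e2 : (fun z : ℝ × ℝ => ((1 - z.1) ^ 2 * (fderiv ℝ α z (1, 0) * fderiv ℝ β z (0, 1)
        - fderiv ℝ α z (0, 1) * fderiv ℝ β z (1, 0))
        - 2 * (1 - z.1) * (α z * fderiv ℝ β z (0, 1)))) = fun z =>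
      (((1 - z.1) ^ 2) • (α z • ((fderiv ℝ (fderiv ℝ β) z).flip (0, 1)) +
        (fderiv ℝ β z (0, 1)) • fderiv ℝ α z) + (α z * fderiv ℝ β z (0, 1)) •
        ((2 * (1 - z.1)) • (-(ContinuousLinearMap.fst ℝ ℝ ℝ)))) (1, 0) +
      (-(((1 - z.1) ^ 2) • (α z • ((fderiv ℝ (fderiv ℝ β) z).flip (1, 0)) +
        (fderiv ℝ β z (1, 0)) • fderiv ℝ α z) + (α z * fderiv ℝ β z (1, 0)) •
        ((2 * (1 - z.1)) • (-(ContinuousLinearMap.fst ℝ ℝ ℝ))))) (0, 1) := by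
    funext z
    simp [e z]
    ring
  have hintg : IntegrableOn (fun z : ℝ × ℝ => ((1 - z.1) ^ 2 *
        (fderiv ℝ α z (1, 0) * fderiv ℝ β z (0, 1)
        - fderiv ℝ α z (0, 1) * fderiv ℝ β z (1, 0))
        - 2 * (1 - z.1) * (α z * fderiv ℝ β z (0, 1)))) (Set.Icc ((0 : ℝ), -R) (1, R)) := by
    apply ContinuousOn.integrableOn_compact isCompact_Icc
    fun_prop
  rw [e2] at hintg ⊢
  refine (key ?_).trans ?_
  · exact hintg
  · simp [h0, h1]

lemma aux_half (G : ℝ × ℝ → ℝ) (hG : Continuous G) (hp : ∀ z, 0 ≤ G z) (R : ℝ) :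
    ∫ z in Set.Icc ((0 : ℝ), -R) (1, R), G (z.1 / 2, z.2)
      ≤ 2 * ∫ z in Set.Icc ((0 : ℝ), -R) (1, R), G z := by
  have hG2 : Continuous fun z : ℝ × ℝ => G (z.1 / 2, z.2) := by fun_prop
  have i1 : IntegrableOn G (Set.Icc ((0 : ℝ), -R) (1, R)) (volume.prod volume) :=
    hG.continuousOn.integrableOn_compact isCompact_Icc
  have i2 : IntegrableOn (fun z : ℝ × ℝ => G (z.1 / 2, z.2)) (Set.Icc ((0 : ℝ), -R) (1, R))
      (volume.prod volume) :=
    hG2.continuousOn.integrableOn_compact isCompact_Icc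
  rw [Measure.volume_eq_prod]
  rw [← Set.Icc_prod_Icc] at *
  rw [setIntegral_prod _ i1, setIntegral_prod _ i2]
  set H : ℝ → ℝ := fun t => ∫ y in Set.Icc (-R) R, G (t, y) with hH
  have Hc : Continuous H := by
    apply continuous_parametric_integral_of_continuous (f := fun t y => G (t, y)) _ isCompact_Icc
    simpa [Function.uncurry_def] using hG
  have Hp : ∀ t, 0 ≤ H t := fun t => integral_nonneg fun y => hp _
  change ∫ t in Set.Icc 0 1, H (t / 2) ≤ 2 * ∫ t in Set.Icc 0 1, H t
  rw [integral_Icc_eq_integral_Ioc, integral_Icc_eq_integral_Ioc,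
    ← intervalIntegral.integral_of_le zero_le_one, ← intervalIntegral.integral_of_le zero_le_one,
    intervalIntegral.integral_comp_div _ two_ne_zero]
  have hs := intervalIntegral.integral_add_adjacent_intervals
    (Hc.intervalIntegrable (μ := volume) 0 (1/2)) (Hc.intervalIntegrable (1/2) 1)
  have hn : 0 ≤ ∫ t in (1/2 : ℝ)..1, H t :=
    intervalIntegral.integral_nonneg (by norm_num) fun t _ => Hp t
  simp only [zero_div, smul_eq_mul]
  linarith

lemma aux_alg (ψ a b f a2 b1 ap bp fp a2p b1p : ℝ) (h0 : 0 ≤ ψ) (h1 : ψ ≤ 1) :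
   ψ^2*b^2 ≤ 2*(ψ^2*((b+f)*b - a2*b1) - 2*ψ*(a*b) - (ψ^2*((2*(bp+fp)-3*(b+f))*(-2*bp+3*b) - (4*a2p-3*a2)*(-b1p+3*b1)) - 2*ψ*((4*ap-3*a)*(-2*bp+3*b)))) + 100000*((f^2+a2^2+b1^2+a^2)+(fp^2+a2p^2+b1p^2+ap^2)) := by
  have hs : ψ^2 ≤ 1 := by nlinarith
  obtain ⟨B, hB⟩ : ∃ B, B = -2*bp+3*b := ⟨_, rfl⟩
  obtain ⟨F, hF⟩ : ∃ F, F = 2*fp-3*f := ⟨_, rfl⟩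
  obtain ⟨A, hA⟩ : ∃ A, A = 4*ap-3*a := ⟨_, rfl⟩
  obtain ⟨X, hX⟩ : ∃ X, X = 4*a2p-3*a2 := ⟨_, rfl⟩
  obtain ⟨Y, hY⟩ : ∃ Y, Y = -b1p+3*b1 := ⟨_, rfl⟩
  have e : 2*(bp+fp)-3*(b+f) = -B+F := by rw [hB, hF]; ring
  rw [e, ← hB, ← hA, ← hX, ← hY]
  have F2 : F^2 ≤ 26*(f^2+fp^2) := by rw [hF]; nlinarith [sq_nonneg (3*fp+2*f)]
  have A2 : A^2 ≤ 50*(a^2+ap^2) := by rw [hA]; nlinarith [sq_nonneg (3*ap+4*a)]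
  have X2 : X^2 ≤ 50*(a2^2+a2p^2) := by rw [hX]; nlinarith [sq_nonneg (3*a2p+4*a2)]
  have Y2 : Y^2 ≤ 20*(b1^2+b1p^2) := by rw [hY]; nlinarith [sq_nonneg (3*b1p+b1)]
  have mono : ∀ u : ℝ, ψ^2*u^2 ≤ u^2 := fun u => by nlinarith [sq_nonneg u]
  have t1 := sq_nonneg (ψ*b/2+2*(ψ*f))
  have t2 := sq_nonneg (ψ*b/2-4*a)
  have t3 := sq_nonneg (ψ*B/2-2*(ψ*F))
  have t4 := sq_nonneg (ψ*B/2+4*A)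
  have t5 := mul_nonneg (sq_nonneg ψ) (sq_nonneg (a2-b1))
  have t6 := mul_nonneg (sq_nonneg ψ) (sq_nonneg (X+Y))
  have := mono f
  have := mono F
  have := mono a2
  have := mono b1
  have := mono X
  have := mono Y
  have := mul_nonneg (sq_nonneg ψ) (sq_nonneg B)
  have := mul_nonneg (sq_nonneg ψ) (sq_nonneg b)
  nlinarith [sq_nonneg f, sq_nonneg a, sq_nonneg a2, sq_nonneg b1,sq_nonneg fp, sq_nonneg ap, sq_nonneg a2p, sq_nonneg b1p]

lemma aux_fderiv_half {α : ℝ × ℝ → ℝ} (hα : ContDiff ℝ 2 α) (c d : ℝ) (z w : ℝ × ℝ) :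
    fderiv ℝ (fun z : ℝ × ℝ => c * α (z.1 / 2, z.2) + d * α z) z w
      = c * fderiv ℝ α (z.1 / 2, z.2) (w.1 / 2, w.2) + d * fderiv ℝ α z w := by
  have hA : ∀ z, HasFDerivAt α (fderiv ℝ α z) z := fun z =>
    (hα.differentiable (by norm_num) z).hasFDerivAt
  let M : ℝ × ℝ →L[ℝ] ℝ × ℝ :=
    ((1 / 2 : ℝ) • ContinuousLinearMap.fst ℝ ℝ ℝ).prod (ContinuousLinearMap.snd ℝ ℝ ℝ)
  have hM : ∀ z, M z = (z.1 / 2, z.2) := fun z => by simp [M]; ring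
  have h1 : HasFDerivAt (fun z : ℝ × ℝ => α (z.1 / 2, z.2))
      ((fderiv ℝ α (z.1 / 2, z.2)).comp M) z := by
    have := (hA (M z)).comp z M.hasFDerivAt
    rw [hM z] at this
    exact this.congr_of_eventuallyEq (Filter.Eventually.of_forall fun y => by simp [hM])
  have h2 : HasFDerivAt (fun z : ℝ × ℝ => c * α (z.1 / 2, z.2) + d * α z) _ z := (h1.const_mul c).add ((hA z).const_mul d)
  rw [HasFDerivAt.fderiv h2]
  simp [hM]

lemma aux_unit {α β : ℝ × ℝ → ℝ} (hα : ContDiff ℝ 2 α) (hβ : ContDiff ℝ 2 β) (R : ℝ) (hR : 0 ≤ R)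
    (h0 : ∀ t, α (t, R) = 0) (h1 : ∀ t, α (t, -R) = 0) :
    ∫ z in Set.Icc ((0 : ℝ), -R) (1, R), (1 - z.1) ^ 2 * (fderiv ℝ β z (0, 1)) ^ 2
    ≤ 300000 * ∫ z in Set.Icc ((0 : ℝ), -R) (1, R),
      ((fderiv ℝ α z (1, 0) - fderiv ℝ β z (0, 1)) ^ 2 + (fderiv ℝ α z (0, 1)) ^ 2
        + (fderiv ℝ β z (1, 0)) ^ 2 + (α z) ^ 2) := by
  have hαc := hα.continuous
  have ca := aux_cont_fderiv hα
  have cb := aux_cont_fderiv hβ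
  set Q : ℝ × ℝ → ℝ := fun z => ((fderiv ℝ α z (1, 0) - fderiv ℝ β z (0, 1)) ^ 2
    + (fderiv ℝ α z (0, 1)) ^ 2 + (fderiv ℝ β z (1, 0)) ^ 2 + (α z) ^ 2) with hQ
  have cQ : Continuous Q := by fun_prop
  have hhalf := aux_half Q cQ (fun z => by simp only [hQ]; positivity) R
  have cQ2 : Continuous fun z : ℝ × ℝ => Q (z.1 / 2, z.2) := by fun_prop
  set A : ℝ × ℝ → ℝ := fun z => 4 * α (z.1 / 2, z.2) + (-3) * α z with hA
  set B : ℝ × ℝ → ℝ := fun z => (-2) * β (z.1 / 2, z.2) + 3 * β z with hB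
  have cA : ContDiff ℝ 2 A := by fun_prop
  have cB : ContDiff ℝ 2 B := by fun_prop
  have cAc := cA.continuous
  have cA' := aux_cont_fderiv cA
  have cB' := aux_cont_fderiv cB
  have d1 := aux_div hα hβ R hR h0 h1
  have d2 := aux_div cA cB R hR (fun t => by simp [hA, h0]) (fun t => by simp [hA, h1])
  have fA : ∀ z w, fderiv ℝ A z w = _ := fun z w => aux_fderiv_half hα 4 (-3) z w
  have fB : ∀ z w, fderiv ℝ B z w = _ := fun z w => aux_fderiv_half hβ (-2) 3 z w
  have hb : ∀ y : ℝ, A (0, y) * fderiv ℝ B (0, y) (0, 1) = α (0, y) * fderiv ℝ β (0, y) (0, 1) := by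
    intro y
    rw [fB]
    simp only [hA, zero_div]
    ring
  simp only [hb] at d2
  set D1 : ℝ × ℝ → ℝ := fun z => ((1 - z.1) ^ 2 * (fderiv ℝ α z (1, 0) * fderiv ℝ β z (0, 1)
        - fderiv ℝ α z (0, 1) * fderiv ℝ β z (1, 0))
        - 2 * (1 - z.1) * (α z * fderiv ℝ β z (0, 1))) with hD1
  set D2 : ℝ × ℝ → ℝ := fun z => ((1 - z.1) ^ 2 * (fderiv ℝ A z (1, 0) * fderiv ℝ B z (0, 1)
        - fderiv ℝ A z (0, 1) * fderiv ℝ B z (1, 0))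
        - 2 * (1 - z.1) * (A z * fderiv ℝ B z (0, 1))) with hD2
  have cD1 : Continuous D1 := by fun_prop
  have cD2 : Continuous D2 := by fun_prop
  have I : ∀ g : ℝ × ℝ → ℝ, Continuous g → IntegrableOn g (Set.Icc ((0 : ℝ), -R) (1, R)) :=
    fun g hg => hg.continuousOn.integrableOn_compact isCompact_Icc
  have main : ∫ z in Set.Icc ((0 : ℝ), -R) (1, R), (1 - z.1) ^ 2 * (fderiv ℝ β z (0, 1)) ^ 2
      ≤ ∫ z in Set.Icc ((0 : ℝ), -R) (1, R),
        (2 * (D1 z - D2 z) + 100000 * (Q z + Q (z.1 / 2, z.2))) := by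
    apply setIntegral_mono_on (I _ (by fun_prop)) (I _ (by fun_prop)) measurableSet_Icc
    intro z hz
    have hz0 : 0 ≤ z.1 := hz.1.1
    have hz1 : z.1 ≤ 1 := hz.2.1
    have hs : ∀ (γ : ℝ × ℝ → ℝ) (u : ℝ × ℝ), fderiv ℝ γ u (1 / 2, 0) = fderiv ℝ γ u (1, 0) / 2 := by
      intro γ u
      have : ((1 / 2, 0) : ℝ × ℝ) = (1 / 2 : ℝ) • (1, 0) := by simp
      rw [this, map_smul, smul_eq_mul]; ring
    have := aux_alg (1 - z.1) (α z) (fderiv ℝ β z (0, 1))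
      (fderiv ℝ α z (1, 0) - fderiv ℝ β z (0, 1)) (fderiv ℝ α z (0, 1)) (fderiv ℝ β z (1, 0))
      (α (z.1 / 2, z.2)) (fderiv ℝ β (z.1 / 2, z.2) (0, 1))
      (fderiv ℝ α (z.1 / 2, z.2) (1, 0) - fderiv ℝ β (z.1 / 2, z.2) (0, 1))
      (fderiv ℝ α (z.1 / 2, z.2) (0, 1)) (fderiv ℝ β (z.1 / 2, z.2) (1, 0))
      (by linarith) (by linarith)
    refine this.trans (le_of_eq ?_)
    simp only [hD1, hD2, fA, fB, hQ, hs, zero_div]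
    simp only [hA]
    ring
  rw [integral_add (I _ (by fun_prop)) (I _ (by fun_prop)), integral_const_mul, integral_const_mul,
    integral_sub (I _ (by fun_prop)) (I _ (by fun_prop)),
    integral_add (I _ (by fun_prop)) (I _ (by fun_prop))] at main
  linarith

lemma aux_box (H : ℝ × ℝ → ℝ) (hH : Continuous H) (R : ℝ) :
    ∫ z in Set.Icc ((0 : ℝ), -R) (1, R), H z
      = ∫ t in (0 : ℝ)..1, ∫ y in Set.Icc (-R) R, H (t, y) := by
  have i1 : IntegrableOn H (Set.Icc ((0 : ℝ), -R) (1, R)) (volume.prod volume) :=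
    hH.continuousOn.integrableOn_compact isCompact_Icc
  rw [Measure.volume_eq_prod]
  rw [← Set.Icc_prod_Icc] at *
  rw [setIntegral_prod _ i1, integral_Icc_eq_integral_Ioc,
    ← intervalIntegral.integral_of_le zero_le_one]

lemma aux_refl (H : ℝ × ℝ → ℝ) (hH : Continuous H) (R : ℝ) :
    ∫ z in Set.Icc ((0 : ℝ), -R) (1, R), H (1 - z.1, z.2)
      = ∫ z in Set.Icc ((0 : ℝ), -R) (1, R), H z := by
  rw [aux_box H hH, aux_box (fun z => H (1 - z.1, z.2)) (by fun_prop)]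
  simp only
  rw [intervalIntegral.integral_comp_sub_left (fun t => ∫ y in Set.Icc (-R) R, H (t, y)) 1]
  simp

abbrev aff (p L : ℝ) (z : ℝ × ℝ) : Fin 2 → ℝ := ![p + L * z.1, z.2]

lemma aff_contDiff (p L : ℝ) : ContDiff ℝ 2 (aff p L) := by
  rw [contDiff_pi]
  intro i
  fin_cases i
  · simp [aff]; fun_prop
  · simp [aff]; fun_prop

lemma aux_cont_jac {v : (Fin 2 → ℝ) → (Fin 2 → ℝ)} (hv : ContDiff ℝ 2 v) (i j : Fin 2) :
    Continuous fun x => jacobian v x i j := by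
  have h : Continuous fun x => fderiv ℝ v x (Pi.single j 1) :=
    (hv.continuous_fderiv (by norm_num)).clm_apply continuous_const
  exact (continuous_apply i).comp h

lemma aux_fderiv_aff {v : (Fin 2 → ℝ) → (Fin 2 → ℝ)} (hv : ContDiff ℝ 2 v) (p L : ℝ) (i : Fin 2)
    (c : ℝ) (z w : ℝ × ℝ) :
    fderiv ℝ (fun z => c * v (aff p L z) i) z w
      = c * (L * w.1 * jacobian v (aff p L z) i 0 + w.2 * jacobian v (aff p L z) i 1) := by
  have haff : HasFDerivAt (aff p L) (ContinuousLinearMap.pi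
      ![L • ContinuousLinearMap.fst ℝ ℝ ℝ, ContinuousLinearMap.snd ℝ ℝ ℝ]) z := by
    rw [hasFDerivAt_pi']
    intro i
    fin_cases i
    · have := ((hasFDerivAt_fst (𝕜 := ℝ) (p := z)).const_mul L).const_add p
      refine this.congr_fderiv ?_
      ext <;> simp
    · have := (hasFDerivAt_snd (𝕜 := ℝ) (p := z))
      refine this.congr_fderiv ?_
      ext <;> simp
  have h1 := ((hv.differentiable (by norm_num) (aff p L z)).hasFDerivAt).comp z haff
  have h2 := ((hasFDerivAt_pi'.1 h1 i).const_mul c)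
  have h3 : HasFDerivAt (fun z => c * v (aff p L z) i) _ z := h2
  rw [h3.fderiv]
  have hw : (ContinuousLinearMap.pi
      ![L • ContinuousLinearMap.fst ℝ ℝ ℝ, ContinuousLinearMap.snd ℝ ℝ ℝ]) w
      = (L * w.1) • (Pi.single 0 1 : Fin 2 → ℝ) + w.2 • (Pi.single 1 1 : Fin 2 → ℝ) := by
    ext k
    fin_cases k <;> simp
  simp only [_root_.smul_apply, ContinuousLinearMap.comp_apply, hw, map_add, map_smul]
  simp [jacobian]

/-- the good quantity -/
noncomputable def good (v : (Fin 2 → ℝ) → (Fin 2 → ℝ)) (x : Fin 2 → ℝ) : ℝ :=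
  (jacobian v x 0 0 - jacobian v x 1 1) ^ 2 + (jacobian v x 0 1) ^ 2 + (jacobian v x 1 0) ^ 2
    + ((v x 0) ^ 2 + (v x 1) ^ 2)

lemma good_cont {v : (Fin 2 → ℝ) → (Fin 2 → ℝ)} (hv : ContDiff ℝ 2 v) : Continuous (good v) := by
  have h := aux_cont_jac hv
  have hc := hv.continuous
  unfold good
  fun_prop

lemma aux_side {v : (Fin 2 → ℝ) → (Fin 2 → ℝ)} (hv : ContDiff ℝ 2 v) (p L : ℝ) (hL : L ≠ 0)
    (R : ℝ) (hR : 0 ≤ R) (h0 : ∀ s, v ![s, R] = 0) (h1 : ∀ s, v ![s, -R] = 0) :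
    ∫ z in Set.Icc ((0 : ℝ), -R) (1, R), (1 - z.1) ^ 2 * (jacobian v (aff p L z) 1 1) ^ 2
    ≤ 300000 * (1 + L ^ 2 + L⁻¹ ^ 2) *
      ∫ z in Set.Icc ((0 : ℝ), -R) (1, R), good v (aff p L z) := by
  have ha := aff_contDiff p L
  have hac := ha.continuous
  have I : ∀ g : ℝ × ℝ → ℝ, Continuous g → IntegrableOn g (Set.Icc ((0 : ℝ), -R) (1, R)) :=
    fun g hg => hg.continuousOn.integrableOn_compact isCompact_Icc
  have hvi : ∀ i, ContDiff ℝ 2 fun z => v (aff p L z) i := fun i =>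
    contDiff_pi.1 (hv.comp ha) i
  have hj := aux_cont_jac hv
  have hvc := hv.continuous
  have hg := good_cont hv
  have := aux_unit (α := fun z => L⁻¹ * v (aff p L z) 0) (β := fun z => 1 * v (aff p L z) 1)
    (contDiff_const.mul (hvi 0)) (contDiff_const.mul (hvi 1)) R hR
    (fun t => by simp [aff, h0]) (fun t => by simp [aff, h1])
  simp only [aux_fderiv_aff hv] at this
  simp only [mul_zero, zero_mul, zero_add, one_mul, mul_one, add_zero] at this
  refine this.trans ?_
  rw [mul_assoc, ← integral_const_mul (1 + L ^ 2 + L⁻¹ ^ 2)]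
  refine mul_le_mul_of_nonneg_left ?_ (by norm_num)
  apply integral_mono (I _ (by fun_prop)) (I _ (by fun_prop))
  intro z
  simp only [good]
  rw [inv_mul_cancel_left₀ hL]
  set J := jacobian v (aff p L z)
  set u := v (aff p L z)
  have a1 := sq_nonneg (J 0 0 - J 1 1)
  have a2 := sq_nonneg (J 0 1)
  have a3 := sq_nonneg (J 1 0)
  have a4 := sq_nonneg (u 0)
  have a5 := sq_nonneg (u 1)
  have b1 := sq_nonneg L
  have b2 := sq_nonneg L⁻¹
  simp only [mul_pow]
  nlinarith [mul_nonneg a1 b1, mul_nonneg a2 b1, mul_nonneg a3 b1, mul_nonneg a4 b1,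
    mul_nonneg a5 b1, mul_nonneg a1 b2, mul_nonneg a2 b2, mul_nonneg a3 b2, mul_nonneg a4 b2,
    mul_nonneg a5 b2]

lemma aux_strip {v : (Fin 2 → ℝ) → (Fin 2 → ℝ)} (hv : ContDiff ℝ 2 v) (p L : ℝ) (hL : L ≠ 0)
    (R : ℝ) (hR : 0 ≤ R) (h0 : ∀ s, v ![s, R] = 0) (h1 : ∀ s, v ![s, -R] = 0) :
    0 ≤ ∫ z in Set.Icc ((0 : ℝ), -R) (1, R),
      (((9600000 * (1 + L ^ 2 + L⁻¹ ^ 2) + 2) * good v (aff p L z))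
        - (divg v (aff p L z)) ^ 2) := by
  have hac := (aff_contDiff p L).continuous
  have hac2 := (aff_contDiff (p + L) (-L)).continuous
  have I : ∀ g : ℝ × ℝ → ℝ, Continuous g → IntegrableOn g (Set.Icc ((0 : ℝ), -R) (1, R)) :=
    fun g hg => hg.continuousOn.integrableOn_compact isCompact_Icc
  have hj := aux_cont_jac hv
  have hvc := hv.continuous
  have hg := good_cont hv
  have s1 := aux_side hv p L hL R hR h0 h1
  have s2 := aux_side hv (p + L) (-L) (neg_ne_zero.2 hL) R hR h0 h1
  have e : ∀ z : ℝ × ℝ, aff (p + L) (-L) z = aff p L (1 - z.1, z.2) := by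
    intro z; simp [aff]; ring
  have r1 := aux_refl (fun z => z.1 ^ 2 * (jacobian v (aff p L z) 1 1) ^ 2) (by fun_prop) R
  have r2 := aux_refl (fun z => good v (aff p L z)) (by fun_prop) R
  simp only [e, r2, inv_neg, neg_sq] at s2
  simp only at r1
  rw [r1] at s2
  have hd : ∀ x, divg v x = jacobian v x 0 0 + jacobian v x 1 1 := fun x => by
    simp [divg, Matrix.trace_fin_two]
  simp only [hd]
  rw [integral_sub (I _ (by fun_prop)) (I _ (by fun_prop)), integral_const_mul]
  have m : ∫ z in Set.Icc ((0 : ℝ), -R) (1, R),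
      (jacobian v (aff p L z) 0 0 + jacobian v (aff p L z) 1 1) ^ 2 ≤
      ∫ z in Set.Icc ((0 : ℝ), -R) (1, R), (16 * ((1 - z.1) ^ 2 * (jacobian v (aff p L z) 1 1) ^ 2
        + z.1 ^ 2 * (jacobian v (aff p L z) 1 1) ^ 2) + 2 * good v (aff p L z)) := by
    apply integral_mono (I _ (by fun_prop)) (I _ (by fun_prop))
    intro z
    simp only [good]
    set J := jacobian v (aff p L z)
    set u := v (aff p L z)
    nlinarith [sq_nonneg (J 0 1), sq_nonneg (J 1 0), sq_nonneg (u 0), sq_nonneg (u 1),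
      mul_nonneg (sq_nonneg (1 - 2 * z.1)) (sq_nonneg (J 1 1)), sq_nonneg (J 0 0 - 3 * J 1 1)]
  rw [integral_add (I _ (by fun_prop)) (I _ (by fun_prop)), integral_const_mul,
    integral_add (I _ (by fun_prop)) (I _ (by fun_prop)), integral_const_mul] at m
  linarith

lemma aux_null {a b : (Fin 2 → ℝ) → ℝ} (ha : ContDiff ℝ 2 a) (hb : ContDiff ℝ 2 b)
    (hsa : HasCompactSupport a) (u w : Fin 2 → ℝ) :
    ∫ x, fderiv ℝ a x u * fderiv ℝ b x w = ∫ x, fderiv ℝ a x w * fderiv ℝ b x u := by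
  have h : ContDiff ℝ 1 (fderiv ℝ b) := hb.fderiv_right (by norm_num)
  have hd : ∀ w, ContDiff ℝ 1 fun x => fderiv ℝ b x w := fun w => h.clm_apply contDiff_const
  have hca : ∀ w, Continuous fun x => fderiv ℝ a x w := fun w =>
    (ha.continuous_fderiv (by norm_num)).clm_apply continuous_const
  have hcb : ∀ w, Continuous fun x => fderiv ℝ b x w := fun w => (hd w).continuous
  have hcs : ∀ w, HasCompactSupport fun x => fderiv ℝ a x w := fun w => hsa.fderiv_apply ℝ w
  have f2 : ∀ x u w, fderiv ℝ (fun x => fderiv ℝ b x w) x u = fderiv ℝ (fderiv ℝ b) x u w := by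
    intro x u w
    have h2 := (h.differentiable (by norm_num) x).hasFDerivAt
    have := h2.clm_apply (hasFDerivAt_const w x)
    rw [this.fderiv]
    simp
  have key : ∀ u w, ∫ x, a x * fderiv ℝ (fun x => fderiv ℝ b x w) x u
      = - ∫ x, fderiv ℝ a x u * fderiv ℝ b x w := by
    intro u w
    have hc2 : Continuous fun x => fderiv ℝ (fun x => fderiv ℝ b x w) x u :=
      ((hd w).continuous_fderiv (by norm_num)).clm_apply continuous_const
    apply integral_mul_fderiv_eq_neg_fderiv_mul_of_integrable
    · exact ((hca u).mul (hcb w)).integrable_of_hasCompactSupport (hcs u).mul_right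
    · exact (ha.continuous.mul hc2).integrable_of_hasCompactSupport hsa.mul_right
    · exact (ha.continuous.mul (hcb w)).integrable_of_hasCompactSupport hsa.mul_right
    · exact fun x _ => ha.differentiable (by norm_num) x
    · exact fun x _ => (hd w).differentiable (by norm_num) x
  have k1 := key u w
  have k2 := key w u
  have : (fun x => a x * fderiv ℝ (fun x => fderiv ℝ b x w) x u)
      = fun x => a x * fderiv ℝ (fun x => fderiv ℝ b x u) x w := by
    funext x
    rw [f2, f2, (hb.contDiffAt.isSymmSndFDerivAt (by simp)) u w]
  rw [this] at k1
  linarith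

lemma aux_one_strip (h : (Fin 2 → ℝ) → ℝ) (hc : Continuous h) (hs : HasCompactSupport h)
    (R : ℝ) (hR : ∀ x : Fin 2 → ℝ, x 1 ∉ Set.Icc (-R) R → h x = 0) (p L : ℝ) (hL : 0 < L) :
    ∫ x in {x : Fin 2 → ℝ | p ≤ x 0 ∧ x 0 < p + L}, h x
      = L * ∫ z in Set.Icc ((0 : ℝ), -R) (1, R), h (aff p L z) := by
  have hac := (aff_contDiff p L).continuous
  have hi := hc.integrable_of_hasCompactSupport (μ := volume) hs
  have mp := (volume_preserving_finTwoArrow ℝ).symm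
  have me := (MeasurableEquiv.finTwoArrow (α := ℝ)).symm.measurableEmbedding
  rw [← mp.setIntegral_preimage_emb me]
  have hset : (MeasurableEquiv.finTwoArrow (α := ℝ)).symm ⁻¹'
      {x : Fin 2 → ℝ | p ≤ x 0 ∧ x 0 < p + L} = Set.Ico p (p + L) ×ˢ Set.univ := by
    ext z
    simp [MeasurableEquiv.finTwoArrow]
  have hintg : Integrable (fun z => h ((MeasurableEquiv.finTwoArrow (α := ℝ)).symm z))
      (volume.prod volume) := (mp.integrable_comp_emb me).2 hi
  have hbox := aux_box (fun z => h (aff p L z)) (hc.comp hac) R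
  rw [hset, hbox, Measure.volume_eq_prod, setIntegral_prod _ hintg.integrableOn,
    integral_Ico_eq_integral_Ioc, ← intervalIntegral.integral_of_le (by linarith)]
  have e := intervalIntegral.smul_integral_comp_add_mul (a := 0) (b := 1)
    (fun s => ∫ y in Set.Icc (-R) R, h ![s, y]) L p
  simp only [mul_zero, add_zero, mul_one, smul_eq_mul] at e
  simp only [aff]
  rw [e]
  congr 1
  funext s
  rw [setIntegral_univ, setIntegral_eq_integral_of_forall_compl_eq_zero]
  · rfl
  · intro y hy
    exact hR _ (by simpa using hy)

lemma aux_phase2 {v : (Fin 2 → ℝ) → (Fin 2 → ℝ)} (hv : ContDiff ℝ 2 v)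
    (hs : HasCompactSupport v) (θ : ℝ) (hθ : θ ∈ Set.Ioo (0 : ℝ) 1) (ε : ℝ) (hε : 0 < ε)
    (C : ℝ) (hC : C = 9600000 * (1 + ((1 - θ) * ε) ^ 2 + ((1 - θ) * ε)⁻¹ ^ 2) + 2)
    (hi : Integrable fun x => C * good v x - (divg v x) ^ 2) :
    0 ≤ ∫ x in {x : Fin 2 → ℝ | ¬ Int.fract (x 0 / ε) < θ}, (C * good v x - (divg v x) ^ 2) := by
  obtain ⟨hθ0, hθ1⟩ := hθ
  set L := (1 - θ) * ε with hLdef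
  have hL : 0 < L := mul_pos (by linarith) hε
  obtain ⟨R1, hR1p, hR1⟩ := hs.exists_pos_le_norm
  obtain ⟨R2, hR2p, hR2⟩ := (hs.fderiv ℝ).exists_pos_le_norm
  set R := max R1 R2
  have hRp : 0 < R := lt_of_lt_of_le hR1p (le_max_left _ _)
  have hn : ∀ x : Fin 2 → ℝ, |x 1| ≤ ‖x‖ := fun x => by
    simpa using norm_le_pi_norm x 1
  have hv0 : ∀ x : Fin 2 → ℝ, R ≤ |x 1| → v x = 0 := fun x hx =>
    hR1 x ((le_max_left _ _).trans (hx.trans (hn x)))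
  have hf0 : ∀ x : Fin 2 → ℝ, R ≤ |x 1| → fderiv ℝ v x = 0 := fun x hx =>
    hR2 x ((le_max_right _ _).trans (hx.trans (hn x)))
  have hd : ∀ x, divg v x = jacobian v x 0 0 + jacobian v x 1 1 := fun x => by
    simp [divg, Matrix.trace_fin_two]
  have hj := aux_cont_jac hv
  have hvc := hv.continuous
  have hg := good_cont hv
  have hzero : ∀ x, v x = 0 → fderiv ℝ v x = 0 → C * good v x - (divg v x) ^ 2 = 0 := by
    intro x h1 h2
    simp [good, hd, jacobian, h1, h2]
  have hcont : Continuous fun x => C * good v x - (divg v x) ^ 2 := by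
    simp only [hd]; fun_prop
  have hcs : HasCompactSupport fun x => C * good v x - (divg v x) ^ 2 := by
    refine hs.mono' ?_
    intro x hx
    by_contra hcon
    apply hx
    exact hzero x (image_eq_zero_of_notMem_tsupport hcon)
      (fderiv_of_notMem_tsupport ℝ hcon)
  have hU : {x : Fin 2 → ℝ | ¬ Int.fract (x 0 / ε) < θ}
      = ⋃ n : ℤ, {x : Fin 2 → ℝ | (n + θ) * ε ≤ x 0 ∧ x 0 < (n + θ) * ε + L} := by
    ext x
    simp only [Set.mem_ofPred_eq, Set.mem_iUnion, not_lt]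
    have e1 : ∀ n : ℤ, (n + θ) * ε + L = (n + 1) * ε := fun n => by rw [hLdef]; ring
    simp only [e1, ← le_div_iff₀ hε, ← div_lt_iff₀ hε]
    constructor
    · intro h
      refine ⟨⌊x 0 / ε⌋, ?_, Int.lt_floor_add_one _⟩
      have := Int.floor_add_fract (x 0 / ε)
      linarith
    · rintro ⟨n, h1, h2⟩
      have : ⌊x 0 / ε⌋ = n := Int.floor_eq_iff.2 ⟨by linarith, h2⟩
      have h3 := Int.floor_add_fract (x 0 / ε)
      rw [this] at h3
      linarith
  rw [hU, integral_iUnion]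
  · refine tsum_nonneg fun n => ?_
    rw [aux_one_strip _ hcont hcs R _ _ L hL]
    · refine mul_nonneg hL.le ?_
      rw [hC]
      exact aux_strip hv _ L hL.ne' R hRp.le
        (fun s => hv0 _ (by simpa using le_abs_self R))
        (fun s => hv0 _ (by simpa using le_abs_self R))
    · intro x hx
      have : R ≤ |x 1| := by
        by_contra hcon
        exact hx (abs_le.1 (not_le.1 hcon).le)
      exact hzero x (hv0 x this) (hf0 x this)
  · intro n
    exact (measurableSet_le measurable_const (measurable_pi_apply 0)).inter
      (measurableSet_lt (measurable_pi_apply 0) measurable_const)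
  · intro n m hnm
    rw [Function.onFun, Set.disjoint_left]
    rintro x ⟨h1, h2⟩ ⟨h3, h4⟩
    apply hnm
    have e1 : ∀ n : ℤ, (n + θ) * ε + L = (n + 1) * ε := fun n => by rw [hLdef]; ring
    rw [e1, ← div_lt_iff₀ hε] at h2 h4
    rw [← le_div_iff₀ hε] at h1 h3
    rw [← Int.floor_eq_iff.2 ⟨by linarith, h2⟩, ← Int.floor_eq_iff.2 ⟨by linarith, h4⟩]
  · exact hi.integrableOn

/-- Coercivity at fixed scale `ε` for the straight-layer two-phase Gutiérrez
microstructure with volume fraction `θ`. -/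
theorem stmt8 (l1 m1 l2 m2 : ℝ)
    (hpos : 0 < m1) (heq : -l2 - m2 = m1) (hlt : m1 < m2) (hvse : 0 < l1 + m1)
    (θ : ℝ) (hθ : θ ∈ Set.Ioo (0 : ℝ) 1) (ε : ℝ) (hε : 0 < ε)
    (Ω : Set (Fin 2 → ℝ)) (hΩo : IsOpen Ω) (hΩb : Bornology.IsBounded Ω) :
    ∃ α : ℝ, 0 < α ∧
      ∀ v : (Fin 2 → ℝ) → (Fin 2 → ℝ), ContDiff ℝ (⊤ : ℕ∞) v → HasCompactSupport v →
        tsupport v ⊆ Ω →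
        α * ∫ x in Ω, ((∑ i, (v x i) ^ 2) + ∑ i, ∑ j, (jacobian v x i j) ^ 2)
          ≤ ∫ x in Ω,
              ((if Int.fract (x 0 / ε) < θ then l1 else l2) * (divg v x) ^ 2
                + 2 * (if Int.fract (x 0 / ε) < θ then m1 else m2) * symGradNormSq v x
                + ∑ i, (v x i) ^ 2) := by
  obtain ⟨C, hC⟩ : ∃ C, C = 9600000 * (1 + ((1 - θ) * ε) ^ 2 + ((1 - θ) * ε)⁻¹ ^ 2) + 2 :=
    ⟨_, rfl⟩
  have hC1 : 1 ≤ C := by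
    rw [hC]
    have := sq_nonneg ((1 - θ) * ε)
    have := sq_nonneg ((1 - θ) * ε)⁻¹
    linarith
  obtain ⟨M, hM⟩ : ∃ M, M = min m1 (min (m2 - m1) 1) := ⟨_, rfl⟩
  have hMp : 0 < M := by rw [hM]; simp [hpos, hlt]
  have hM1 : M ≤ m1 := hM ▸ min_le_left _ _
  have hM2 : M ≤ m2 - m1 := hM ▸ (min_le_right _ _).trans (min_le_left _ _)
  have hM3 : M ≤ 1 := hM ▸ (min_le_right _ _).trans (min_le_right _ _)
  obtain ⟨δ, hδ⟩ : ∃ δ, δ = M / (8 * C) := ⟨_, rfl⟩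
  have hδp : 0 < δ := by rw [hδ]; positivity
  have hδC : 8 * (δ * C) = M := by rw [hδ]; field_simp
  have hδle : δ ≤ δ * C := by nlinarith
  refine ⟨δ, hδp, fun v hv hcs hsub => ?_⟩
  have hv2 : ContDiff ℝ 2 v := hv.of_le (WithTop.coe_le_coe.2 le_top)
  have hj := aux_cont_jac hv2
  have hvc := hv2.continuous
  have hg := good_cont hv2
  have hd : ∀ x, divg v x = jacobian v x 0 0 + jacobian v x 1 1 := fun x => by
    simp [divg, Matrix.trace_fin_two]
  have hv0 : ∀ x, x ∉ tsupport v → v x = 0 := fun x hx => image_eq_zero_of_notMem_tsupport hx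
  have hj0 : ∀ x, x ∉ tsupport v → ∀ i j, jacobian v x i j = 0 := fun x hx i j => by
    simp [jacobian, fderiv_of_notMem_tsupport ℝ hx]
  have hI : ∀ g : (Fin 2 → ℝ) → ℝ, Continuous g → (∀ x, x ∉ tsupport v → g x = 0) →
      Integrable g := by
    intro g hgc hg0
    refine hgc.integrable_of_hasCompactSupport (hcs.mono' ?_)
    intro x hx
    by_contra hcon
    exact hx (hg0 x hcon)
  have hmeas : MeasurableSet {x : Fin 2 → ℝ | Int.fract (x 0 / ε) < θ} :=
    measurableSet_lt (by fun_prop) measurable_const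
  have hite : ∀ (c d : ℝ) (g : (Fin 2 → ℝ) → ℝ), Integrable g →
      Integrable fun x : Fin 2 → ℝ => (if Int.fract (x 0 / ε) < θ then c else d) * g x := by
    intro c d g hgi
    refine hgi.bdd_mul (c := max |c| |d|) ?_ ?_
    · exact (Measurable.ite hmeas measurable_const measurable_const).aestronglyMeasurable
    · refine Filter.Eventually.of_forall fun x => ?_
      split_ifs <;> simp
  have ig : Integrable fun x => C * good v x - (divg v x) ^ 2 := by
    apply hI
    · simp only [hd]; fun_prop
    · intro x hx
      simp [good, hd, hj0 x hx, hv0 x hx]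
  have hp2 := aux_phase2 hv2 hcs θ hθ ε hε C hC ig
  have hP2 : MeasurableSet {x : Fin 2 → ℝ | ¬ Int.fract (x 0 / ε) < θ} := hmeas.compl
  rw [← integral_indicator hP2] at hp2
  have hnull : ∫ x, (jacobian v x 0 0 * jacobian v x 1 1 - jacobian v x 0 1 * jacobian v x 1 0)
      = 0 := by
    have hvi : ∀ i, ContDiff ℝ 2 fun x => v x i := fun i => contDiff_pi.1 hv2 i
    have hfd : ∀ i x w, fderiv ℝ (fun x => v x i) x w = fderiv ℝ v x w i := by
      intro i x w
      have := hasFDerivAt_pi'.1 (hv2.differentiable (by norm_num) x).hasFDerivAt i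
      rw [this.fderiv]
      rfl
    have hs0 : HasCompactSupport fun x => v x 0 :=
      hcs.comp_left (g := fun u : Fin 2 → ℝ => u 0) rfl
    have := aux_null (hvi 0) (hvi 1) hs0 (Pi.single 0 1) (Pi.single 1 1)
    simp only [hfd] at this
    rw [integral_sub (hI _ (by fun_prop) (fun x hx => by simp [hj0 x hx]))
      (hI _ (by fun_prop) (fun x hx => by simp [hj0 x hx]))]
    exact sub_eq_zero.2 this
  have hsg : ∀ x, symGradNormSq v x = (jacobian v x 0 0) ^ 2 + (jacobian v x 1 1) ^ 2
      + (jacobian v x 0 1 + jacobian v x 1 0) ^ 2 / 2 := fun x => by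
    simp only [symGradNormSq, Fin.sum_univ_two]; ring
  rw [setIntegral_eq_integral_of_forall_compl_eq_zero, setIntegral_eq_integral_of_forall_compl_eq_zero]
  rotate_left
  · intro x hx
    have hx' : x ∉ tsupport v := fun h => hx (hsub h)
    simp [hsg, hd, hj0 x hx', hv0 x hx']
  · intro x hx
    have hx' : x ∉ tsupport v := fun h => hx (hsub h)
    simp [hj0 x hx', hv0 x hx']
  have iE : Integrable fun x : Fin 2 → ℝ =>
      ((if Int.fract (x 0 / ε) < θ then l1 else l2) * (divg v x) ^ 2
                + 2 * (if Int.fract (x 0 / ε) < θ then m1 else m2) * symGradNormSq v x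
                + ∑ i, (v x i) ^ 2) := by
    refine ((hite _ _ _ (hI _ ?_ ?_)).add ?_).add (hI _ ?_ ?_)
    · simp only [hd]; fun_prop
    · intro x hx; simp [hd, hj0 x hx]
    · simp only [mul_assoc]
      refine (hite _ _ (fun x => symGradNormSq v x) (hI _ ?_ ?_)).const_mul 2
      · simp only [hsg]; fun_prop
      · intro x hx; simp [hsg, hj0 x hx]
    · fun_prop
    · intro x hx; simp [hv0 x hx]
  have iD : Integrable fun x =>
      jacobian v x 0 0 * jacobian v x 1 1 - jacobian v x 0 1 * jacobian v x 1 0 :=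
    hI _ (by fun_prop) (fun x hx => by simp [hj0 x hx])
  have iF : Integrable fun x => ((∑ i, (v x i) ^ 2) + ∑ i, ∑ j, (jacobian v x i j) ^ 2) :=
    hI _ (by fun_prop) (fun x hx => by simp [hj0 x hx, hv0 x hx])
  have ih := ig.indicator hP2
  have main := integral_mono
    ((iF.const_mul δ).add (ih.const_mul (2 * δ)))
    (iE.add (iD.const_mul (4 * (m1 - δ)))) (by
      intro x
      simp only [Pi.add_apply, Set.indicator_apply, Set.mem_ofPred_eq, Fin.sum_univ_two, hsg, hd,
        good]
      set J := jacobian v x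
      set u := v x
      have s1 := sq_nonneg (J 0 0 + J 1 1)
      have s2 := sq_nonneg (J 0 0 - J 1 1)
      have s3 := sq_nonneg (J 0 1 + J 1 0)
      have s4 := sq_nonneg (J 0 1 - J 1 0)
      have s5 := sq_nonneg (u 0)
      have s6 := sq_nonneg (u 1)
      by_cases hx : Int.fract (x 0 / ε) < θ
      · simp only [hx, not_true, if_true, if_false]
        have k1 : 0 ≤ l1 + m1 + (m1 - δ) - δ := by linarith
        have k2 : 0 ≤ m1 - δ - δ := by linarith
        have k3 : 0 ≤ 1 - δ := by linarith
        have k4 := hδp.le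
        linear_combination mul_nonneg k1 s1 + mul_nonneg k2 s4 + mul_nonneg k3 s5
          + mul_nonneg k3 s6 + δ / 2 * s1 + δ / 2 * s2 + δ / 2 * s3 + δ / 2 * s4
      · simp only [hx, not_false_eq_true, if_true, if_false]
        have hl2 : l2 = -m1 - m2 := by linarith
        subst hl2
        have k1 : 0 ≤ m2 - m1 - 2 * (δ * C) := by linarith
        have k2 : 0 ≤ m1 - 2 * δ - 2 * (δ * C) := by linarith
        have k3 : 0 ≤ 1 - δ - 2 * (δ * C) := by linarith
        have k4 : 0 ≤ δ * C := by linarith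
        linear_combination mul_nonneg k1 s2 + mul_nonneg k1 s3 + mul_nonneg k2 s4
          + mul_nonneg k3 s5 + mul_nonneg k3 s6 + δ / 2 * s1 + δ / 2 * s2 + δ / 2 * s3
          + δ / 2 * s4 + mul_nonneg k4 s3 + mul_nonneg k4 s4)
  simp only [Pi.add_apply] at main
  rw [integral_add (iF.const_mul δ) (ih.const_mul (2 * δ)),
    integral_add iE (iD.const_mul (4 * (m1 - δ))), integral_const_mul, integral_const_mul,
    integral_const_mul, hnull] at main
  have := mul_nonneg (mul_nonneg zero_le_two hδp.le) hp2
  linarith
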